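/- In the parallel-link cost-sharing mechanism with prediction n̂, suppose the prediction underestimates, i.e., n̂ < n where n is the actual number of players. Then in every pure Nash equilibrium p of the induced game, the allocation A(n̂) is fully utilized: the load ℓ_e of every edge e satisfies ℓ_e ≥ ℓ̂_e, where ℓ̂_e is the load assigned to e by the GoWithTheFlow allocation A(n̂). -/

import Mathlib

noncomputable section
open scoped NNReal

namespace ParallelLink

variable {E : Type*} [Fintype E] [DecidableEq E]

/-- The load of an assignment `p` of players to parallel links on edge `e`. -/
def loadOf {n : ℕ} (p : Fin n → E) (e : E) : ℕ :=
  (Finset.univ.filter fun i => p i = e).card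

/-- The total cost of a load vector `L`. -/
def costL (c : E → ℕ → ℝ≥0) (L : E → ℕ) : ℝ≥0 :=
  ∑ e : E, c e (L e)

/-- `c(OPT(q))`: the minimum cost of assigning `q` players to the links. -/
def optCost (c : E → ℕ → ℝ≥0) (q : ℕ) : ℝ≥0 :=
  ⨅ A : Fin q → E, costL c (loadOf A)

/-- The load on edge `e` after the first `q` players of the online stream
`assign` have been assigned (so `loadUpTo assign q` are the loads of the
online allocation `A(q)`). -/
def loadUpTo (assign : ℕ → E) (q : ℕ) (e : E) : ℕ :=
  ((Finset.range q).filter fun j => assign j = e).card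

/-- The modified (penalized) cost function `ĉ_e`:  equal to `c_e` up to the
threshold `ℓ̂_e`, and increasing by at least `W` for each additional user
beyond the threshold. -/
def chat (c : E → ℕ → ℝ≥0) (lhat : E → ℕ) (W : ℝ≥0) (e : E) : ℕ → ℝ≥0
  | 0 => c e 0
  | l + 1 =>
    if l + 1 ≤ lhat e then c e (l + 1)
    else max (chat c lhat W e l + W) (c e (l + 1))

/-- The number of users of edge `e` that precede player `i` in the ordering. -/
def prevUsers {n : ℕ} (p : Fin n → E) (i : Fin n) (e : E) : ℕ :=
  (Finset.univ.filter fun j => j < i ∧ p j = e).card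

/-- The payment of player `i` under the ordered protocol applied to the
modified cost functions: her marginal increase of `ĉ` on the edge she uses. -/
def pay (c : E → ℕ → ℝ≥0) (lhat : E → ℕ) (W : ℝ≥0) {n : ℕ}
    (p : Fin n → E) (i : Fin n) : ℝ≥0 :=
  chat c lhat W (p i) (prevUsers p i (p i) + 1) - chat c lhat W (p i) (prevUsers p i (p i))

/-- Pure Nash equilibrium of the induced parallel-link game: no player can
strictly decrease her payment by unilaterally switching to another link. -/
def IsPNE (c : E → ℕ → ℝ≥0) (lhat : E → ℕ) (W : ℝ≥0) {n : ℕ} (p : Fin n → E) : Prop :=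
  ∀ i : Fin n, ∀ e' : E, pay c lhat W p i ≤ pay c lhat W (Function.update p i e') i

end ParallelLink

open ParallelLink

namespace ParallelLink

theorem chat_eq_of_le {E : Type*} (c : E → ℕ → ℝ≥0) (lhat : E → ℕ) (W : ℝ≥0) (e : E) {l : ℕ}
    (h : l ≤ lhat e) : chat c lhat W e l = c e l := by
  cases l with
  | zero => rfl
  | succ l => rw [chat, if_pos h]

theorem le_chat_succ_sub {E : Type*} (c : E → ℕ → ℝ≥0) (lhat : E → ℕ) (W : ℝ≥0) (e : E) {l : ℕ}
    (h : lhat e ≤ l) : W ≤ chat c lhat W e (l + 1) - chat c lhat W e l := by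
  apply le_tsub_of_add_le_left
  rw [chat, if_neg (by omega)]
  exact le_max_left _ _

theorem sum_loadOf {E : Type*} [Fintype E] [DecidableEq E] {n : ℕ} (p : Fin n → E) :
    ∑ e, loadOf p e = n := by
  simpa [loadOf] using (Finset.card_eq_sum_card_fiberwise
    (s := Finset.univ) (t := Finset.univ) (f := p) (by simp)).symm

theorem sum_loadUpTo {E : Type*} [Fintype E] [DecidableEq E] (assign : ℕ → E) (q : ℕ) :
    ∑ e, loadUpTo assign q e = q := by
  simpa [loadUpTo] using (Finset.card_eq_sum_card_fiberwise
    (s := Finset.range q) (t := Finset.univ) (f := assign) (by simp)).symm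

/-- The last user of a used edge is preceded on it by all of its other users. -/
theorem exists_prevUsers_add_one_eq_loadOf {E : Type*} [DecidableEq E] {n : ℕ} (p : Fin n → E)
    {e : E} (h : 0 < loadOf p e) : ∃ i, p i = e ∧ prevUsers p i e + 1 = loadOf p e := by
  have hne : (Finset.univ.filter fun i => p i = e).Nonempty := Finset.card_pos.mp h
  obtain ⟨i, hi, hmax⟩ := Finset.exists_max_image _ id hne
  refine ⟨i, (Finset.mem_filter.mp hi).2, ?_⟩
  have heq : (Finset.univ.filter fun j => j < i ∧ p j = e)
      = (Finset.univ.filter fun j => p j = e).erase i := by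
    ext j
    simp only [Finset.mem_filter, Finset.mem_univ, true_and, Finset.mem_erase]
    exact ⟨fun hj => ⟨hj.1.ne, hj.2⟩,
      fun hj => ⟨lt_of_le_of_ne (hmax j (by simpa using hj.2)) hj.1, hj.2⟩⟩
  rw [prevUsers, heq, Finset.card_erase_add_one hi, loadOf]

theorem prevUsers_update_le_loadOf {E : Type*} [DecidableEq E] {n : ℕ} (p : Fin n → E)
    (i : Fin n) (e e' : E) : prevUsers (Function.update p i e') i e ≤ loadOf p e := by
  refine Finset.card_le_card fun j hj => ?_
  simp only [Finset.mem_filter, Finset.mem_univ, true_and] at hj ⊢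
  rw [← hj.2, Function.update_of_ne hj.1.ne]

end ParallelLink

/-- **Underprediction case for parallel links.**  In the parallel-link
cost-sharing mechanism with prediction `n̂` (thresholds `ℓ̂ = loadUpTo assign n̂`
given by the 4-competitive GoWithTheFlow online allocation `assign`, penalty
`W = c(A(n̂)) + ε` for some `ε > 0`), if `n̂ < n` then in every pure Nash
equilibrium `p` the allocation `A(n̂)` is fully utilized: the load of every
edge `e` satisfies `ℓ_e ≥ ℓ̂_e`. -/
theorem underprediction_loads_ge {E : Type*} [Fintype E] [DecidableEq E] [Nonempty E]
    (c : E → ℕ → ℝ≥0)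
    (hmono : ∀ e : E, Monotone (c e)) (hzero : ∀ e : E, c e 0 = 0)
    (assign : ℕ → E)
    (hcomp : ∀ q : ℕ, costL c (loadUpTo assign q) ≤ 4 * optCost c q)
    (n nhat : ℕ) (hunder : nhat < n)
    (ε : ℝ≥0) (hε : 0 < ε)
    (p : Fin n → E)
    (hPNE : IsPNE c (loadUpTo assign nhat) (costL c (loadUpTo assign nhat) + ε) p) :
    ∀ e : E, loadUpTo assign nhat e ≤ loadOf p e := by
  intro e
  by_contra! hlt
  obtain ⟨f, -, hf⟩ : ∃ f ∈ Finset.univ, loadUpTo assign nhat f < loadOf p f :=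
    Finset.exists_lt_of_sum_lt (by rwa [sum_loadUpTo, sum_loadOf])
  obtain ⟨i, rfl, hi⟩ := exists_prevUsers_add_one_eq_loadOf p (Nat.zero_lt_of_lt hf)
  have hpay : costL c (loadUpTo assign nhat) + ε ≤
      pay c (loadUpTo assign nhat) (costL c (loadUpTo assign nhat) + ε) p i :=
    le_chat_succ_sub c _ _ _ (by omega)
  have hdev : pay c (loadUpTo assign nhat) (costL c (loadUpTo assign nhat) + ε)
      (Function.update p i e) i ≤ costL c (loadUpTo assign nhat) := by
    have hk : prevUsers (Function.update p i e) i e + 1 ≤ loadUpTo assign nhat e :=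
      (prevUsers_update_le_loadOf p i e e).trans_lt hlt
    rw [pay, Function.update_self]
    calc _ ≤ _ := tsub_le_self
      _ = c e (prevUsers (Function.update p i e) i e + 1) := chat_eq_of_le c _ _ e hk
      _ ≤ c e (loadUpTo assign nhat e) := hmono e hk
      _ ≤ costL c (loadUpTo assign nhat) :=
        Finset.single_le_sum (f := fun e => c e (loadUpTo assign nhat e))
          (fun _ _ => zero_le) (Finset.mem_univ e)
  exact (lt_add_of_pos_right _ hε).not_ge (hpay.trans ((hPNE i e).trans hdev))
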